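/- Let A and B be simple unital complex C*-algebras with A oddly decomposable, φ : GL(A) → GL(B) a group isomorphism, and θ the induced map on idempotents. Let e, f ∈ Ĩ(A) be orthogonal nontrivial idempotents with e + f ≠ 1. If θ(e)θ(f) = 0, then θ(g)θ(h) = 0 for every pair of orthogonal idempotents g, h ∈ I_{c_e}; if θ(1 − e)θ(1 − f) = 0, then θ(1 − g)θ(1 − h) = 0 for every pair of orthogonal idempotents g, h ∈ I_{c_e}. -/

import Mathlib

noncomputable section

/-- The symmetry `1 - 2e` associated to an idempotent `e` is a unit (its own inverse). -/
def symUnit {A : Type*} [Ring A] {e : A} (he : IsIdempotentElem e) : Aˣ where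
  val := 1 - 2 * e
  inv := 1 - 2 * e
  val_inv := by
    have h : e * e = e := he
    have expand : (1 - 2 * e) * (1 - 2 * e) = 1 - 4 * e + 4 * (e * e) := by noncomm_ring
    rw [expand, h]; noncomm_ring
  inv_val := by
    have h : e * e = e := he
    have expand : (1 - 2 * e) * (1 - 2 * e) = 1 - 4 * e + 4 * (e * e) := by noncomm_ring
    rw [expand, h]; noncomm_ring

/-- The map `θ_φ` induced on idempotents by a map `φ` between the groups of invertible
elements, determined by `1 - 2 θ_φ(e) = φ(1 - 2e)`, i.e. `θ_φ(e) = (1 - φ(1 - 2e))/2`;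
it is extended by `0` off the set of idempotents. -/
noncomputable def theta {A B : Type*} [Ring A] [Ring B] [Algebra ℂ B]
    (φ : Aˣ → Bˣ) (e : A) : B :=
  letI := Classical.propDecidable (IsIdempotentElem e)
  if h : IsIdempotentElem e then (2 : ℂ)⁻¹ • ((1 : B) - (φ (symUnit h) : B)) else 0

/-- `a` and `b` are coefficient maps for the idempotent `e` (w.r.t. `φ`):
`φ(λe + 1 - e) = a(λ) θ(e) + b(λ) θ(1-e)` for all nonzero `λ`. -/
def IsCoeffMaps {A B : Type*} [Ring A] [Ring B] [Algebra ℂ A] [Algebra ℂ B]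
    (φ : Aˣ → Bˣ) (e : A) (a b : ℂˣ →* ℂˣ) : Prop :=
  ∀ (lam : ℂˣ) (v : Aˣ), (v : A) = (lam : ℂ) • e + 1 - e →
    (φ v : B) = ((a lam : ℂˣ) : ℂ) • theta φ e + ((b lam : ℂˣ) : ℂ) • theta φ (1 - e)

/-- `c(λ) = a(λ) b(λ)⁻¹`, as an element of `ℂˣ`. -/
def cOf (a b : ℂˣ →* ℂˣ) (lam : ℂˣ) : ℂˣ := a lam * (b lam)⁻¹

/-- `e ∼_c f`: the functions `c_e` and `c_f` agree (for some, equivalently any,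
choice of coefficient maps). -/
def cEquiv {A B : Type*} [Ring A] [Ring B] [Algebra ℂ A] [Algebra ℂ B]
    (φ : Aˣ → Bˣ) (e f : A) : Prop :=
  ∃ ae be af bf : ℂˣ →* ℂˣ, IsCoeffMaps φ e ae be ∧ IsCoeffMaps φ f af bf ∧
    ∀ lam : ℂˣ, cOf ae be lam = cOf af bf lam

/-- The set `I_{c_e}` of nontrivial idempotents `g` with `c_g = c_e`. -/
def Ic {A B : Type*} [Ring A] [Ring B] [Algebra ℂ A] [Algebra ℂ B]
    (φ : Aˣ → Bˣ) (e : A) : Set A :=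
  {g | IsIdempotentElem g ∧ g ≠ 0 ∧ g ≠ 1 ∧ cEquiv φ e g}

/-- `θ_φ` preserves orthogonality on `S`: `θ(g₁)θ(g₂) = 0` for orthogonal `g₁, g₂ ∈ S`. -/
def PreservesOrthOn {A B : Type*} [Ring A] [Ring B] [Algebra ℂ B]
    (φ : Aˣ → Bˣ) (S : Set A) : Prop :=
  ∀ g₁ ∈ S, ∀ g₂ ∈ S, g₁ * g₂ = 0 → g₂ * g₁ = 0 → theta φ g₁ * theta φ g₂ = 0

/-- `θ_φ` flips orthogonality on `S`: `θ(1-g₁)θ(1-g₂) = 0` for orthogonal `g₁, g₂ ∈ S`. -/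
def FlipsOrthOn {A B : Type*} [Ring A] [Ring B] [Algebra ℂ B]
    (φ : Aˣ → Bˣ) (S : Set A) : Prop :=
  ∀ g₁ ∈ S, ∀ g₂ ∈ S, g₁ * g₂ = 0 → g₂ * g₁ = 0 →
    theta φ (1 - g₁) * theta φ (1 - g₂) = 0

/-- A unital ring is oddly decomposable if for every pair of nontrivial idempotents
`e, f` there is an odd integer `n ≥ 3` and `n` pairwise orthogonal nontrivial
idempotents `g₁, …, gₙ` summing to `f`, such that each `gᵢ` is similar to some
nontrivial idempotent `gᵢ'` with `gᵢ' e = e gᵢ' = gᵢ' ≠ e`. -/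
def OddlyDecomposable (A : Type*) [Ring A] : Prop :=
  ∀ e f : A, IsIdempotentElem e → e ≠ 0 → e ≠ 1 → IsIdempotentElem f → f ≠ 0 → f ≠ 1 →
    ∃ n : ℕ, Odd n ∧ 3 ≤ n ∧ ∃ g : Fin n → A,
      (∀ i, IsIdempotentElem (g i) ∧ g i ≠ 0 ∧ g i ≠ 1) ∧
      (∀ i j, i ≠ j → g i * g j = 0) ∧
      (∑ i, g i) = f ∧
      ∀ i, ∃ (g' : A) (u : Aˣ), IsIdempotentElem g' ∧ g' ≠ 0 ∧ g' ≠ 1 ∧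
        g' = (u : A) * g i * ((u⁻¹ : Aˣ) : A) ∧ g' * e = g' ∧ e * g' = g' ∧ g' ≠ e

variable {A B : Type*}
  [NormedRing A] [StarRing A] [CStarRing A] [CompleteSpace A]
  [NormedAlgebra ℂ A] [StarModule ℂ A]
  [NormedRing B] [StarRing B] [CStarRing B] [CompleteSpace B]
  [NormedAlgebra ℂ B] [StarModule ℂ B]

section Simple

theorem IsSimpleRing.span_induction {R : Type*} [Ring R] [IsSimpleRing R] {p : R} (hp : p ≠ 0)
    {P : R → Prop} (mul : ∀ x y, P (x * p * y)) (add : ∀ s t, P s → P t → P (s + t))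
    (neg : ∀ s, P s → P (-s)) : P 1 := by
  have h1 : (1 : R) ∈ TwoSidedIdeal.span {p} :=
    IsSimpleRing.one_mem_of_ne_zero_mem _ hp (TwoSidedIdeal.subset_span rfl)
  rw [TwoSidedIdeal.mem_span_iff_mem_addSubgroup_closure] at h1
  generalize (1 : R) = t at h1
  induction h1 using AddSubgroup.closure_induction with
  | mem t ht =>
    obtain ⟨_, ⟨x, -, q, rfl, rfl⟩, y, -, rfl⟩ := ht
    exact mul x y
  | zero => simpa using mul 0 0
  | add s t _ _ hs ht => exact add s t hs ht
  | neg s _ hs => exact neg s hs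

theorem exists_eq_smul_one_of_central {R : Type*} [NormedRing R] [NormedAlgebra ℂ R]
    [CompleteSpace R] [IsSimpleRing R] {z : R} (hz : ∀ a, z * a = a * z) :
    ∃ α : ℂ, z = α • 1 := by
  obtain ⟨α, hα⟩ := spectrum.nonempty z
  refine ⟨α, ?_⟩
  by_contra hne
  set w := algebraMap ℂ R α - z with hw
  have hw0 : w ≠ 0 := fun h => hne (by
    rw [← Algebra.algebraMap_eq_smul_one]; exact (sub_eq_zero.1 h).symm)
  have hwc : ∀ a, w * a = a * w := fun a => by
    rw [hw, sub_mul, mul_sub, hz, Algebra.commutes]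
  obtain ⟨s, hs⟩ : ∃ s, (1 : R) = w * s := by
    refine IsSimpleRing.span_induction hw0 (P := fun t => ∃ s, t = w * s) ?_ ?_ ?_
    · exact fun x y => ⟨x * y, by rw [← hwc, mul_assoc]⟩
    · rintro _ _ ⟨s, rfl⟩ ⟨t, rfl⟩
      exact ⟨s + t, by rw [mul_add]⟩
    · rintro _ ⟨s, rfl⟩
      exact ⟨-s, by rw [mul_neg]⟩
  exact hα ⟨⟨w, s, hs.symm, by rw [← hwc, ← hs]⟩, rfl⟩

theorem exists_eq_smul_of_central_corner {R : Type*} [NormedRing R] [NormedAlgebra ℂ R]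
    [CompleteSpace R] [IsSimpleRing R] {p z : R} (hp : p * p = p) (hpz : p * z = z)
    (hzp : z * p = z) (hz : ∀ b, z * (p * b * p) = p * b * p * z) :
    ∃ α : ℂ, z = α • p := by
  by_cases hp0 : p = 0
  · exact ⟨0, by rw [← hpz, hp0]; simp⟩
  obtain ⟨s, hs, hw⟩ : ∃ s, (∀ a, s * a * p = 1 * a * z) ∧
      ∀ w, (∀ a, w * a * p = a * z) → ∀ a, w * a * 1 = a * s := by
    refine IsSimpleRing.span_induction hp0 (P := fun t => ∃ s, (∀ a, s * a * p = t * a * z) ∧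
      ∀ w, (∀ a, w * a * p = a * z) → ∀ a, w * a * t = a * s) ?_ ?_ ?_
    · refine fun x y => ⟨x * z * y, fun a => ?_, fun w h a => ?_⟩
      · calc x * z * y * a * p = x * (z * p) * y * a * p := by rw [hzp]
          _ = x * (z * (p * (y * a) * p)) := by
            nth_rewrite 1 [← hzp]
            simp only [mul_assoc]
            rw [← mul_assoc p p, hp]
          _ = x * p * y * a * z := by rw [hz, ← hpz]; simp only [mul_assoc, hpz]
      · calc w * a * (x * p * y) = (w * (a * x) * p) * y := by simp only [mul_assoc]
          _ = _ := by rw [h]; simp only [mul_assoc]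
    · rintro t t' ⟨s, h1, h2⟩ ⟨s', h1', h2'⟩
      exact ⟨s + s', fun a => by simp only [add_mul, h1, h1'],
        fun w h a => by rw [mul_add, mul_add, h2 w h, h2' w h]⟩
    · rintro t ⟨s, h1, h2⟩
      exact ⟨-s, fun a => by simp only [neg_mul, h1],
        fun w h a => by rw [mul_neg, mul_neg, h2 w h]⟩
  have hs' : ∀ a, s * a * p = a * z := fun a => by rw [hs, one_mul]
  obtain ⟨α, hα⟩ := exists_eq_smul_one_of_central (z := s) fun a => by
    simpa using hw s hs' a
  refine ⟨α, ?_⟩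
  have := hs' 1
  rw [hα] at this
  simpa using this.symm

theorem commute_of_commute_units {R : Type*} [NormedRing R] [NormedAlgebra ℂ R]
    [CompleteSpace R] {p v : R}
    (hv : ∀ w : Rˣ, (w : R) * p = p * w → (w : R) * v = v * w) {b : R} (hb : b * p = p * b) :
    b * v = v * b := by
  obtain ⟨k, hk⟩ := NormedField.exists_lt_norm ℂ (‖b‖ * ‖(1 : R)‖)
  obtain ⟨u, hu⟩ := spectrum.mem_resolventSet_of_norm_lt_mul hk
  have h := hv u (by rw [hu, sub_mul, mul_sub, hb, Algebra.commutes])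
  rw [hu, sub_mul, mul_sub, Algebra.commutes] at h
  exact sub_right_injective h

theorem exists_eq_smul_add_smul_of_commute_units {R : Type*} [NormedRing R] [NormedAlgebra ℂ R]
    [CompleteSpace R] [IsSimpleRing R] {p v : R} (hp : p * p = p) (hvp : v * p = p * v)
    (hv : ∀ w : Rˣ, (w : R) * p = p * w → (w : R) * v = v * w) :
    ∃ α β : ℂ, v = α • p + β • (1 - p) := by
  have key : ∀ e : R, e * e = e → e * p = p * e → v * e = e * v →
      (∀ b, e * b * e * p = p * (e * b * e)) → ∃ α : ℂ, v * e = α • e := by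
    intro e he hep hve h
    refine exists_eq_smul_of_central_corner he ?_ ?_ fun b => ?_
    · rw [hve, ← mul_assoc, he]
    · rw [mul_assoc, he]
    · have h1 := commute_of_commute_units hv (h b)
      calc v * e * (e * b * e) = v * (e * e * b * e) := by simp only [mul_assoc]
          _ = e * b * e * v := by rw [he, h1]
          _ = e * b * (e * e) * v := by rw [he]
          _ = _ := by rw [hve]; simp only [mul_assoc]
  obtain ⟨α, hα⟩ := key p hp rfl hvp fun b => by
    rw [← mul_assoc, ← mul_assoc, hp, mul_assoc (p * b), hp]
  obtain ⟨β, hβ⟩ := key (1 - p) (IsIdempotentElem.one_sub hp) (by noncomm_ring)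
    (by rw [mul_sub, sub_mul, hvp]; simp) fun b => by
      have h1 : (1 - p) * p = 0 := by rw [sub_mul, hp]; simp
      have h2 : p * (1 - p) = 0 := by rw [mul_sub, hp]; simp
      rw [mul_assoc _ (1 - p), h1, ← mul_assoc, ← mul_assoc, h2]; simp
  exact ⟨α, β, by rw [← hα, ← hβ]; noncomm_ring⟩

end Simple

section Comm

variable {C : Type*} [CommRing C] [Algebra ℂ C]

open scoped IsMulCommutative in
theorem exists_commRing_model.{u} {R : Type u} [Ring R] [Algebra ℂ R] {s : Set R}
    (hs : ∀ a ∈ s, ∀ b ∈ s, a * b = b * a) :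
    ∃ (C : Type u) (_ : CommRing C) (_ : Algebra ℂ C) (f : C →ₐ[ℂ] R),
      Function.Injective f ∧ ∀ a ∈ s, ∃ x, f x = a :=
  have := Algebra.isMulCommutative_adjoin ℂ hs
  ⟨Algebra.adjoin ℂ s, inferInstance, inferInstance,
    (Algebra.adjoin ℂ s).val, Subtype.val_injective,
    fun a ha => ⟨⟨a, Algebra.subset_adjoin ha⟩, rfl⟩⟩

theorem eq_zero_of_two_mul {R : Type*} [Ring R] [Algebra ℂ R] {x : R} (h : 2 * x = 0) : x = 0 := by
  have : (2 : ℂ) • x = 0 := by rw [two_smul, ← two_mul, h]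
  simpa using this

theorem idem_eq_add_or {p q r : C} (hp : p * p = p) (hq : q * q = q) (hr : r * r = r)
    (hp0 : p ≠ 0) (hp1 : p ≠ 1) {a ν : ℂ} (ha : a ^ 4 = -1)
    (h : (a • p + (1 - p)) * (a • q + (1 - q)) = ν • (a • r + (1 - r))) :
    r = p + q ∨ r = p + q - 1 := by
  have ha0 : a ≠ 0 := by rintro rfl; norm_num at ha
  have ha1 : a ≠ 1 := by rintro rfl; norm_num at ha
  have ha3 : a ^ 3 ≠ 1 := fun h3 => by
    have : a = -1 := by rw [← ha, pow_succ, h3, one_mul]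
    rw [this] at h3; norm_num at h3
  have key : ∀ (k : ℂ) (x : C), algebraMap ℂ C k * x = 0 → k ≠ 0 → x = 0 := fun k x hx hk => by
    rw [← Algebra.smul_def] at hx
    exact (smul_eq_zero.1 hx).resolve_left hk
  rw [Algebra.smul_def ν] at h
  have on : ∀ {e : C}, e * e = e → e * (a • e + (1 - e)) = algebraMap ℂ C a * e := fun {e} he => by
    rw [Algebra.smul_def]
    linear_combination (algebraMap ℂ C a - 1) * he
  have off : ∀ {e : C}, e * e = e →
      (1 - e) * (a • e + (1 - e)) = algebraMap ℂ C 1 * (1 - e) := fun {e} he => by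
    rw [Algebra.smul_def, map_one]
    linear_combination (1 - algebraMap ℂ C a) * he
  have atom : ∀ {P Q S : C} {α β γ : ℂ}, P * (a • p + (1 - p)) = algebraMap ℂ C α * P →
      Q * (a • q + (1 - q)) = algebraMap ℂ C β * Q →
      S * (a • r + (1 - r)) = algebraMap ℂ C γ * S → α * β - ν * γ ≠ 0 → P * Q * S = 0 := by
    intro P Q S α β γ hP hQ hS
    refine key _ _ ?_
    simp only [map_sub, map_mul]
    linear_combination P * Q * S * h - Q * (a • q + (1 - q)) * S * hP
      - algebraMap ℂ C α * P * S * hQ + algebraMap ℂ C ν * P * Q * hS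
  have t1 := atom (on hp) (on hq) (on hr)
  have t2 := atom (on hp) (on hq) (off hr)
  have t3 := atom (on hp) (off hq) (on hr)
  have t4 := atom (on hp) (off hq) (off hr)
  have t5 := atom (off hp) (on hq) (on hr)
  have t6 := atom (off hp) (on hq) (off hr)
  have t7 := atom (off hp) (off hq) (on hr)
  have t8 := atom (off hp) (off hq) (off hr)
  by_cases h1 : ν = 1
  · subst h1
    left
    linear_combination -t1 (by grind) - 2 * t2 (by grind) - t4 (by grind) - t6 (by grind) +
      t7 (by grind)
  by_cases h2 : ν = a
  · subst h2
    right
    linear_combination -t2 (by grind) + t3 (by grind) + t5 (by grind) + 2 * t7 (by grind) +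
      t8 (by grind)
  exfalso
  have u3 := t3 (by grind)
  have u4 := t4 (by grind)
  by_cases h3 : ν = a ^ 2
  · have u5 := t5 (by grind)
    have u6 := t6 (by grind)
    have u7 := t7 (by grind)
    have u8 := t8 (by grind)
    exact hp1 (by linear_combination -u5 - u6 - u7 - u8)
  · have u1 := t1 (by grind)
    have u2 := t2 (by grind)
    exact hp0 (by linear_combination u1 + u2 + u3 + u4)

theorem eq_or_mul_eq_one_of_idem_prod {p q : C} (hp : p * p = p) (hq : q * q = q)
    {a b s t : ℂ} (h : (a • p + (1 - p)) * (b • q + (1 - q)) =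
      s • (p + q - 2 * p * q) + t • (1 - (p + q - 2 * p * q))) :
    (p * q ≠ 0 → (1 - p) * (1 - q) ≠ 0 → a * b = 1) ∧
      (p * (1 - q) ≠ 0 → (1 - p) * q ≠ 0 → a = b) := by
  have key : ∀ (k : ℂ) (x : C), algebraMap ℂ C k * x = 0 → x ≠ 0 → k = 0 := fun k x hx hk => by
    rw [← Algebra.smul_def] at hx
    exact (smul_eq_zero.1 hx).resolve_right hk
  simp only [Algebra.smul_def] at h
  have t1 := key (a * b - t) (p * q) (by simp only [map_sub, map_mul]; grind)
  have t2 := key (1 - t) ((1 - p) * (1 - q)) (by simp only [map_sub, map_one]; grind)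
  have t3 := key (a - s) (p * (1 - q)) (by simp only [map_sub]; grind)
  have t4 := key (b - s) ((1 - p) * q) (by simp only [map_sub]; grind)
  exact ⟨fun h1 h2 => by linear_combination t1 h1 - t2 h2,
    fun h3 h4 => by linear_combination t3 h3 - t4 h4⟩

theorem four_idem_sum_ne_two {q₁ q₂ q₃ q₄ : C}
    (h₁ : q₁ * q₁ = q₁) (h₂ : q₂ * q₂ = q₂) (h₃ : q₃ * q₃ = q₃) (h₄ : q₄ * q₄ = q₄)
    (n₁ : q₁ ≠ 0 ∧ q₁ ≠ 1) (n₂ : q₂ ≠ 0 ∧ q₂ ≠ 1) (n₃ : q₃ ≠ 0 ∧ q₃ ≠ 1) (n₄ : q₄ ≠ 0 ∧ q₄ ≠ 1)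
    (h12 : q₁ * q₂ = 0 ∨ (1 - q₁) * (1 - q₂) = 0)
    (h13 : q₁ * q₃ = 0 ∨ (1 - q₁) * (1 - q₃) = 0)
    (h14 : q₁ * q₄ = 0 ∨ (1 - q₁) * (1 - q₄) = 0) :
    q₁ + q₂ + q₃ + q₄ ≠ 2 := by
  intro hs
  have opp0 : ∀ {a b c d : C}, a * a = a → b * b = b → c * c = c → d * d = d →
      a + b + c + d = 2 → a * b = 0 → (1 - c) * (1 - d) = 0 := by
    intro a b c d ha hb hc hd h hab
    refine eq_zero_of_two_mul ?_
    grind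
  have opp1 : ∀ {a b c d : C}, a * a = a → b * b = b → c * c = c → d * d = d →
      a + b + c + d = 2 → (1 - a) * (1 - b) = 0 → c * d = 0 := by
    intro a b c d ha hb hc hd h hab
    refine eq_zero_of_two_mul ?_
    grind
  have star0 : ∀ {a b c d : C}, a * a = a → 
      a + b + c + d = 2 → a * b = 0 → a * c = 0 → a * d = 0 → a = 0 := by
    intro a b c d ha h hb hc hd
    linear_combination -(a * h) + ha + hb + hc + hd
  have star1 : ∀ {a b c d : C}, a * a = a → 
      a + b + c + d = 2 → (1 - a) * (1 - b) = 0 → (1 - a) * (1 - c) = 0 →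
      (1 - a) * (1 - d) = 0 → a = 1 := by
    intro a b c d ha h hb hc hd
    linear_combination (a - 1) * h - ha - hb - hc - hd
  have h34 : (q₁ * q₂ = 0 ∧ (1 - q₃) * (1 - q₄) = 0) ∨ 
      ((1 - q₁) * (1 - q₂) = 0 ∧ q₃ * q₄ = 0) :=
    h12.imp (fun h => ⟨h, opp0 h₁ h₂ h₃ h₄ hs h⟩) (fun h => ⟨h, opp1 h₁ h₂ h₃ h₄ hs h⟩)
  have h24 : (q₁ * q₃ = 0 ∧ (1 - q₂) * (1 - q₄) = 0) ∨ 
      ((1 - q₁) * (1 - q₃) = 0 ∧ q₂ * q₄ = 0) :=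
    h13.imp (fun h => ⟨h, opp0 h₁ h₃ h₂ h₄ (by rw [← hs]; ring) h⟩)
      (fun h => ⟨h, opp1 h₁ h₃ h₂ h₄ (by rw [← hs]; ring) h⟩)
  have h23 : (q₁ * q₄ = 0 ∧ (1 - q₂) * (1 - q₃) = 0) ∨ 
      ((1 - q₁) * (1 - q₄) = 0 ∧ q₂ * q₃ = 0) :=
    h14.imp (fun h => ⟨h, opp0 h₁ h₄ h₂ h₃ (by rw [← hs]; ring) h⟩)
      (fun h => ⟨h, opp1 h₁ h₄ h₂ h₃ (by rw [← hs]; ring) h⟩)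
  have hs2 : q₂ + q₁ + q₃ + q₄ = 2 := by rw [← hs]; ring
  have hs3 : q₃ + q₁ + q₂ + q₄ = 2 := by rw [← hs]; ring
  have hs4 : q₄ + q₁ + q₂ + q₃ = 2 := by rw [← hs]; ring
  rcases h34 with ⟨a, a'⟩ | ⟨a, a'⟩ <;> rcases h24 with ⟨b, b'⟩ | ⟨b, b'⟩ <;>
    rcases h23 with ⟨c, c'⟩ | ⟨c, c'⟩
  · exact n₁.1 (star0 h₁ hs a b c)
  · exact n₄.2 (star1 h₄ hs4 (by rw [mul_comm, c]) (by rw [mul_comm, b']) (by rw [mul_comm, a']))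
  · exact n₃.2 (star1 h₃ hs3 (by rw [mul_comm, b]) (by rw [mul_comm, c']) a')
  · exact n₂.1 (star0 h₂ hs2 (by rw [mul_comm, a]) c' b')
  · exact n₂.2 (star1 h₂ hs2 (by rw [mul_comm, a]) c' b')
  · exact n₃.1 (star0 h₃ hs3 (by rw [mul_comm, b]) (by rw [mul_comm, c']) a')
  · exact n₄.1 (star0 h₄ hs4 (by rw [mul_comm, c]) (by rw [mul_comm, b']) (by rw [mul_comm, a']))
  · exact n₁.2 (star1 h₁ hs a b c)
end Comm

section Image

/-- A nontrivial idempotent: `x * x = x` with `x ≠ 0` and `x ≠ 1`. -/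
structure IsNontrivialIdem {R : Type*} [Ring R] (x : R) : Prop where
  idem : x * x = x
  ne_zero : x ≠ 0
  ne_one : x ≠ 1

namespace IsNontrivialIdem

variable {R : Type*} [Ring R] {x y : R}

theorem mul_one_sub (hx : IsNontrivialIdem x) : x * (1 - x) = 0 := by
  rw [mul_sub, hx.idem, mul_one, sub_self]

theorem one_sub_mul (hx : IsNontrivialIdem x) : (1 - x) * x = 0 := by
  rw [sub_mul, hx.idem, one_mul, sub_self]

theorem one_sub (hx : IsNontrivialIdem x) : IsNontrivialIdem (1 - x) :=
  ⟨IsIdempotentElem.one_sub hx.idem, fun h => hx.ne_one (sub_eq_zero.1 h).symm,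
    fun h => hx.ne_zero (by simpa using h)⟩

theorem conj (hx : IsNontrivialIdem x) (u : Rˣ) :
    IsNontrivialIdem ((u : R) * x * ((u⁻¹ : Rˣ) : R)) where
  idem := by
    calc (u : R) * x * ((u⁻¹ : Rˣ) : R) * ((u : R) * x * ((u⁻¹ : Rˣ) : R))
        = (u : R) * x * (((u⁻¹ : Rˣ) : R) * (u : R)) * x * ((u⁻¹ : Rˣ) : R) := by
          simp only [mul_assoc]
      _ = (u : R) * (x * x) * ((u⁻¹ : Rˣ) : R) := by
          rw [Units.inv_mul, mul_one]; simp only [mul_assoc]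
      _ = _ := by rw [hx.idem]
  ne_zero h := hx.ne_zero (by simpa using h)
  ne_one h := hx.ne_one (by
    rw [Units.mul_inv_eq_iff_eq_mul, one_mul] at h
    exact u.isUnit.mul_left_cancel (by rw [h, mul_one]))

theorem add (hx : IsNontrivialIdem x) (hy : IsNontrivialIdem y) (hxy : x * y = 0)
    (hyx : y * x = 0) (h1 : x + y ≠ 1) : IsNontrivialIdem (x + y) where
  idem := by rw [mul_add, add_mul, add_mul, hx.idem, hy.idem, hxy, hyx]; simp
  ne_zero h := hx.ne_zero (by
    have := congrArg (x * ·) h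
    simpa [mul_add, hx.idem, hxy] using this)
  ne_one := h1

theorem coeff_ext [Algebra ℂ R] (hx : IsNontrivialIdem x) {a b a' b' : ℂ}
    (h : a • x + b • (1 - x) = a' • x + b' • (1 - x)) : a = a' ∧ b = b' := by
  have h1 := congrArg (x * ·) h
  have h2 := congrArg ((1 - x) * ·) h
  simp only [mul_add, mul_smul_comm, hx.idem, hx.mul_one_sub, smul_zero, add_zero,
    hx.one_sub_mul, hx.one_sub.idem, zero_add] at h1 h2
  exact ⟨smul_left_injective ℂ hx.ne_zero h1, smul_left_injective ℂ hx.one_sub.ne_zero h2⟩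

end IsNontrivialIdem

variable {R S : Type*} [Ring R] [Algebra ℂ R] [Ring S] [Algebra ℂ S]

/-- The unit `λ x + (1 - x)` attached to an idempotent `x` and a nonzero scalar `λ`. -/
def idemUnit {x : R} (hx : x * x = x) (lam : ℂˣ) : Rˣ where
  val := (lam : ℂ) • x + (1 - x)
  inv := ((lam⁻¹ : ℂˣ) : ℂ) • x + (1 - x)
  val_inv := by
    simp only [add_mul, mul_add, hx, smul_mul_assoc, mul_smul_comm, mul_sub, sub_mul]
    simp
  inv_val := by
    simp only [add_mul, mul_add, hx, smul_mul_assoc, mul_smul_comm, mul_sub, sub_mul]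
    simp

/-- `q` is a nontrivial idempotent with `φ(λ x + 1 - x) ∈ ℂˣ (c(λ) q + 1 - q)` for all `λ`. -/
structure IsImage (φ : Rˣ ≃* Sˣ) (c : ℂˣ →* ℂˣ) (x : R) (q : S) : Prop
    extends IsNontrivialIdem q where
  map_eq : ∀ (lam : ℂˣ) (v : Rˣ), (v : R) = (lam : ℂ) • x + (1 - x) →
    ∃ μ : ℂˣ, (φ v : S) = (μ : ℂ) • ((c lam : ℂ) • q + (1 - q))

theorem exists_apply_pow_four_eq {c : ℂˣ →* ℂˣ} (hc : c (-1) = -1) :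
    ∃ lam : ℂˣ, (c lam : ℂ) ^ 4 = -1 := by
  obtain ⟨z, hz⟩ := IsAlgClosed.exists_pow_nat_eq (-1 : ℂ) (n := 4) (by norm_num)
  have hz0 : z ≠ 0 := by rintro rfl; norm_num at hz
  refine ⟨Units.mk0 z hz0, ?_⟩
  have h : (Units.mk0 z hz0) ^ 4 = -1 := by ext; simpa using hz
  rw [← Units.val_pow_eq_pow_val, ← map_pow, h, hc]; simp

namespace IsImage

variable {φ : Rˣ ≃* Sˣ} {c d m : ℂˣ →* ℂˣ} {x y : R} {p q r : S}

theorem map_symUnit (h : IsImage φ c x q) (hc : c (-1) = -1) (hx : IsIdempotentElem x) :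
    ∃ μ : ℂˣ, (φ (symUnit hx) : S) = (μ : ℂ) • (1 - 2 * q) := by
  obtain ⟨μ, hμ⟩ := h.map_eq (-1) (symUnit hx) (by
    change 1 - 2 * x = _
    simp only [Units.val_neg, Units.val_one, neg_smul, one_smul]; noncomm_ring)
  refine ⟨μ, hμ.trans ?_⟩
  rw [hc]
  simp only [Units.val_neg, Units.val_one, neg_smul, one_smul]
  congr 1; noncomm_ring

theorem commute (hp : IsImage φ c x p) (hq : IsImage φ d y q) (hc : c (-1) = -1)
    (hd : d (-1) = -1) (hx : IsIdempotentElem x) (hy : IsIdempotentElem y)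
    (hxy : x * y = y * x) : p * q = q * p := by
  obtain ⟨μ, hμ⟩ := hp.map_symUnit hc hx
  obtain ⟨ν, hν⟩ := hq.map_symUnit hd hy
  have h : symUnit hx * symUnit hy = symUnit hy * symUnit hx := by
    ext
    change (1 - 2 * x) * (1 - 2 * y) = (1 - 2 * y) * (1 - 2 * x)
    have h1 : (1 - 2 * x) * (1 - 2 * y) = 1 - 2 * x - 2 * y + 4 * (x * y) := by noncomm_ring
    have h2 : (1 - 2 * y) * (1 - 2 * x) = 1 - 2 * x - 2 * y + 4 * (y * x) := by noncomm_ring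
    rw [h1, h2, hxy]
  have h' := congrArg (fun v => (φ v : S)) h
  simp only [map_mul, Units.val_mul, hμ, hν, smul_mul_smul_comm] at h'
  rw [mul_comm (ν : ℂ)] at h'
  have h3 := smul_right_injective S (mul_ne_zero μ.ne_zero ν.ne_zero) h'
  have h4 : 2 * (2 * (p * q - q * p)) = 0 := by
    have : 2 * (2 * (p * q - q * p)) =
      (1 - 2 * p) * (1 - 2 * q) - (1 - 2 * q) * (1 - 2 * p) := by noncomm_ring
    rw [this, h3, sub_self]
  exact sub_eq_zero.1 (eq_zero_of_two_mul (eq_zero_of_two_mul h4))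

theorem one_sub (h : IsImage φ c x q) (hx : x * x = x)
    (hφ : ∀ (k : ℂˣ) (v : Rˣ), (v : R) = (k : ℂ) • 1 → ∃ μ : ℂˣ, (φ v : S) = (μ : ℂ) • 1) :
    IsImage φ c (1 - x) (1 - q) where
  toIsNontrivialIdem := h.toIsNontrivialIdem.one_sub
  map_eq lam v hv := by
    obtain ⟨μ, hμ⟩ := h.map_eq lam⁻¹ (idemUnit hx lam⁻¹) rfl
    obtain ⟨ν, hν⟩ := hφ lam (v * (idemUnit hx lam⁻¹)⁻¹) (by
      rw [Units.val_mul, Units.mul_inv_eq_iff_eq_mul, hv]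
      change _ = _ * (_ + (1 - x))
      rw [smul_one_mul, smul_add, smul_smul, Units.mul_inv, one_smul]
      abel)
    refine ⟨ν * μ * c lam⁻¹, ?_⟩
    have : (φ v : S) = φ (v * (idemUnit hx lam⁻¹)⁻¹) * φ (idemUnit hx lam⁻¹) := by
      rw [← Units.val_mul, ← map_mul]; simp
    have hc : ((c lam⁻¹ : ℂˣ) : ℂ) * (c lam : ℂ) = 1 := by
      rw [map_inv, Units.inv_mul]
    rw [this, hμ, hν, smul_mul_smul_comm, one_mul, Units.val_mul, Units.val_mul,
      mul_smul _ ((c lam⁻¹ : ℂˣ) : ℂ), smul_add ((c lam⁻¹ : ℂˣ) : ℂ),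
      smul_smul ((c lam⁻¹ : ℂˣ) : ℂ), hc, one_smul, sub_sub_cancel, add_comm (1 - q)]

theorem inv (h : IsImage φ c x q) : IsImage φ c⁻¹ x (1 - q) where
  toIsNontrivialIdem := h.toIsNontrivialIdem.one_sub
  map_eq lam v hv := by
    obtain ⟨μ, hμ⟩ := h.map_eq lam v hv
    refine ⟨μ * c lam, hμ.trans ?_⟩
    rw [Units.val_mul, mul_smul, smul_add (c lam : ℂ), smul_smul (c lam : ℂ), MonoidHom.inv_apply,
      Units.mul_inv, one_smul, sub_sub_cancel, add_comm]

theorem conj (h : IsImage φ c x q) (u : Rˣ) :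
    IsImage φ c ((u : R) * x * ((u⁻¹ : Rˣ) : R)) ((φ u : S) * q * (((φ u)⁻¹ : Sˣ) : S)) where
  toIsNontrivialIdem := h.toIsNontrivialIdem.conj (φ u)
  map_eq lam v hv := by
    obtain ⟨μ, hμ⟩ := h.map_eq lam (u⁻¹ * v * u) (by
      simp only [Units.val_mul, hv, mul_add, add_mul, mul_sub, sub_mul, mul_smul_comm,
        smul_mul_assoc, mul_assoc, Units.inv_mul, mul_one, Units.inv_mul_cancel_left, one_mul])
    refine ⟨μ, ?_⟩
    have hv' : (φ v : S) = φ u * φ (u⁻¹ * v * u) * (((φ u)⁻¹ : Sˣ) : S) := by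
      rw [← Units.val_mul, ← map_mul, ← map_inv, ← Units.val_mul, ← map_mul]
      congr 2; group
    rw [hv', hμ]
    simp only [mul_add, add_mul, mul_sub, sub_mul, mul_smul_comm, smul_mul_assoc, mul_one,
      Units.mul_inv]

theorem hom_eq (h : IsImage φ c x q) (h' : IsImage φ d x q) (hx : x * x = x) : c = d := by
  ext lam
  obtain ⟨μ, hμ⟩ := h.map_eq lam (idemUnit hx lam) rfl
  obtain ⟨ν, hν⟩ := h'.map_eq lam (idemUnit hx lam) rfl
  rw [hμ, smul_add, smul_add, smul_smul, smul_smul] at hν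
  obtain ⟨h1, h2⟩ := h.coeff_ext hν
  rw [h2] at h1
  exact mul_left_cancel₀ ν.ne_zero h1

theorem eq_or_eq_one_sub (hp : p * p = p) (hq : q * q = q) (hq1 : q ≠ 1) {μ : ℂˣ}
    (h : (1 - 2 * p) = (μ : ℂ) • (1 - 2 * q)) : p = q ∨ p = 1 - q := by
  have sq : ∀ {e : S}, e * e = e → (1 - 2 * e) * (1 - 2 * e) = 1 := fun {e} he => by
    have : (1 - 2 * e) * (1 - 2 * e) = 1 - 4 * e + 4 * (e * e) := by noncomm_ring
    rw [this, he]; noncomm_ring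
  have hμ : (μ : ℂ) * μ = 1 := by
    have h1 := sq hp
    rw [h, smul_mul_smul_comm, sq hq] at h1
    have : Nontrivial S := ⟨q, 1, hq1⟩
    exact smul_left_injective ℂ (one_ne_zero (α := S)) (h1.trans (one_smul ℂ _).symm)
  rcases mul_self_eq_one_iff.1 hμ with h1 | h1
  · left
    rw [h1, one_smul] at h
    refine sub_eq_zero.1 (eq_zero_of_two_mul ?_)
    have : 2 * (p - q) = (1 - 2 * q) - (1 - 2 * p) := by noncomm_ring
    rw [this, h, sub_self]
  · right
    rw [h1, neg_smul, one_smul] at h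
    refine sub_eq_zero.1 (eq_zero_of_two_mul ?_)
    have : 2 * (p - (1 - q)) = - (1 - 2 * q) - (1 - 2 * p) := by noncomm_ring
    rw [this, h, sub_self]

theorem unique (hp : IsImage φ c x p) (hq : IsImage φ c x q) (hc : c (-1) = -1)
    (hx : x * x = x) : p = q := by
  obtain ⟨μ, hμ⟩ := hp.map_symUnit hc hx
  obtain ⟨ν, hν⟩ := hq.map_symUnit hc hx
  have h : 1 - 2 * p = ((μ⁻¹ * ν : ℂˣ) : ℂ) • (1 - 2 * q) := by
    rw [Units.val_mul, mul_smul, ← hν, hμ, smul_smul, Units.inv_mul, one_smul]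
  rcases eq_or_eq_one_sub hp.idem hq.idem hq.ne_one h with h | h
  · exact h
  · exfalso
    subst h
    have hcc : c = c⁻¹ := by
      have := hp.inv
      rw [sub_sub_cancel] at this
      exact hq.hom_eq this hx
    obtain ⟨lam, hl⟩ := exists_apply_pow_four_eq hc
    have h1 : c lam * c lam = 1 := by
      nth_rewrite 1 [hcc]; simp
    have h2 : (c lam : ℂ) * c lam = 1 := by rw [← Units.val_mul, h1]; rfl
    have h3 : (c lam : ℂ) ^ 4 = 1 := by linear_combination ((c lam : ℂ) ^ 2 + 1) * h2
    rw [h3] at hl; norm_num at hl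

theorem exists_prod (hp : IsImage φ c x p) (hq : IsImage φ d y q) (hr : IsImage φ m (x + y) r)
    (hx : x * x = x) (hy : y * y = y) (hxy : x * y = 0) (lam : ℂˣ) :
    ∃ ν : ℂˣ, ((c lam : ℂ) • p + (1 - p)) * ((d lam : ℂ) • q + (1 - q)) =
      (ν : ℂ) • ((m lam : ℂ) • r + (1 - r)) := by
  obtain ⟨μ, hμ⟩ := hp.map_eq lam (idemUnit hx lam) rfl
  obtain ⟨ν, hν⟩ := hq.map_eq lam (idemUnit hy lam) rfl
  obtain ⟨κ, hκ⟩ := hr.map_eq lam (idemUnit hx lam * idemUnit hy lam) (by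
    change ((lam : ℂ) • x + (1 - x)) * ((lam : ℂ) • y + (1 - y)) = _
    simp only [mul_add, add_mul, mul_sub, sub_mul, mul_smul_comm, smul_mul_assoc, hxy, smul_zero,
      mul_one, one_mul, smul_add]
    abel)
  rw [map_mul, Units.val_mul, hμ, hν, smul_mul_smul_comm] at hκ
  refine ⟨μ⁻¹ * ν⁻¹ * κ, ?_⟩
  rw [Units.val_mul, mul_smul, ← hκ, smul_smul]
  simp only [Units.val_mul]
  have : (((μ⁻¹ : ℂˣ) : ℂ) * ((ν⁻¹ : ℂˣ) : ℂ) * ((μ : ℂ) * ν)) = 1 := by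
    rw [mul_mul_mul_comm]; simp
  rw [this, one_smul]

theorem add_eq_or (hp : IsImage φ c x p) (hq : IsImage φ c y q) (hr : IsImage φ c (x + y) r)
    (hc : c (-1) = -1) (hx : x * x = x) (hy : y * y = y) (hxy : x * y = 0) (hyx : y * x = 0) :
    r = p + q ∨ r = p + q - 1 := by
  have hs : (x + y) * (x + y) = x + y := by
    rw [mul_add, add_mul, add_mul, hx, hy, hxy, hyx]; simp
  have h1 : p * q = q * p := hp.commute hq hc hc hx hy (by rw [hxy, hyx])
  have h2 : p * r = r * p := hp.commute hr hc hc hx hs (by rw [mul_add, add_mul, hxy, hyx])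
  have h3 : q * r = r * q := hq.commute hr hc hc hy hs (by rw [mul_add, add_mul, hxy, hyx])
  obtain ⟨lam, hl⟩ := exists_apply_pow_four_eq hc
  obtain ⟨ν, hν⟩ := hp.exists_prod hq hr hx hy hxy lam
  obtain ⟨C, _, _, F, hF, hC⟩ := exists_commRing_model (s := {p, q, r}) (by
    rintro a (rfl | rfl | rfl) b (rfl | rfl | rfl) <;> simp [h1, h2, h3])
  obtain ⟨p', rfl⟩ := hC p (by simp)
  obtain ⟨q', rfl⟩ := hC q (by simp)
  obtain ⟨r', rfl⟩ := hC r (by simp)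
  have := idem_eq_add_or (p := p') (q := q') (r := r') (hF (by simpa using hp.idem))
    (hF (by simpa using hq.idem)) (hF (by simpa using hr.idem))
    (fun h => hp.ne_zero (by simp [h])) (fun h => hp.ne_one (by simp [h])) hl
    (hF (by simpa using hν))
  rcases this with rfl | rfl <;> simp

theorem exists_of_orthogonal (hp : IsImage φ c x p) (hq : IsImage φ d y q)
    (hr : IsImage φ m (x + y) r) (hc : c (-1) = -1) (hd : d (-1) = -1) (hm : m (-1) = -1)
    (hx : x * x = x) (hy : y * y = y) (hxy : x * y = 0) (hyx : y * x = 0) :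
    ∃ q', IsImage φ c y q' := by
  have h1 : p * q = q * p := hp.commute hq hc hd hx hy (by rw [hxy, hyx])
  have hsq : ∀ {e : S}, ((-1 : ℂˣ) : ℂ) • e + (1 - e) = 1 - 2 * e := fun {e} => by
    simp only [Units.val_neg, Units.val_one, neg_smul, one_smul]; noncomm_ring
  obtain ⟨ε, hε⟩ := hp.exists_prod hq hr hx hy hxy (-1)
  rw [hc, hd, hm, hsq, hsq, hsq] at hε
  have hrs : p + q - 2 * p * q = r ∨ p + q - 2 * p * q = 1 - r := by
    refine eq_or_eq_one_sub (μ := ε) ?_ hr.idem hr.ne_one ?_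
    · obtain ⟨C, _, _, F, hF, hC⟩ := exists_commRing_model (s := {p, q}) (by
        rintro a (rfl | rfl) b (rfl | rfl) <;> simp [h1])
      obtain ⟨p', rfl⟩ := hC p (by simp)
      obtain ⟨q', rfl⟩ := hC q (by simp)
      have e1 : p' * p' = p' := hF (by simpa using hp.idem)
      have e2 : q' * q' = q' := hF (by simpa using hq.idem)
      have : (p' + q' - 2 * p' * q') * (p' + q' - 2 * p' * q') = p' + q' - 2 * p' * q' := by
        linear_combination (1 - 4 * q' + 4 * q' * q') * e1 + (1) * e2
      simpa [map_ofNat F 2] using congrArg F this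
    · rw [← hε]; noncomm_ring
  have key : ∀ lam, (p * q ≠ 0 → (1 - p) * (1 - q) ≠ 0 → (c lam : ℂ) * d lam = 1) ∧
      (p * (1 - q) ≠ 0 → (1 - p) * q ≠ 0 → (c lam : ℂ) = d lam) := by
    intro lam
    obtain ⟨ν, hν⟩ := hp.exists_prod hq hr hx hy hxy lam
    obtain ⟨s, t, hst⟩ : ∃ s t : ℂ, ((c lam : ℂ) • p + (1 - p)) * ((d lam : ℂ) • q + (1 - q)) =
        s • (p + q - 2 * p * q) + t • (1 - (p + q - 2 * p * q)) := by
      rcases hrs with h | h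
      · exact ⟨ν * m lam, ν, by rw [hν, h, smul_add, smul_smul]⟩
      · exact ⟨ν, ν * m lam, by rw [hν, h, smul_add, smul_smul, sub_sub_cancel, add_comm]⟩
    obtain ⟨C, _, _, F, hF, hC⟩ := exists_commRing_model (s := {p, q}) (by
      rintro a (rfl | rfl) b (rfl | rfl) <;> simp [h1])
    obtain ⟨p', rfl⟩ := hC p (by simp)
    obtain ⟨q', rfl⟩ := hC q (by simp)
    have := eq_or_mul_eq_one_of_idem_prod (p := p') (q := q') (hF (by simpa using hp.idem))
      (hF (by simpa using hq.idem)) (hF (by simpa [map_ofNat F 2] using hst))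
    exact ⟨fun h h' => this.1 (fun h0 => h (by rw [← map_mul, h0, map_zero]))
        (fun h0 => h' (by simpa using congrArg F h0)),
      fun h h' => this.2 (fun h0 => h (by simpa using congrArg F h0))
        (fun h0 => h' (by simpa using congrArg F h0))⟩
  by_cases hcd : p * (1 - q) ≠ 0 ∧ (1 - p) * q ≠ 0
  · have : c = d := MonoidHom.ext fun lam => Units.ext ((key lam).2 hcd.1 hcd.2)
    exact ⟨q, this ▸ hq⟩
  by_cases hcd' : p * q ≠ 0 ∧ (1 - p) * (1 - q) ≠ 0
  · have : c = d⁻¹ := MonoidHom.ext fun lam =>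
      eq_inv_of_mul_eq_one_left (Units.ext ((key lam).1 hcd'.1 hcd'.2))
    exact ⟨1 - q, this ▸ hq.inv⟩
  exfalso
  rw [not_and_or, not_not, not_not] at hcd hcd'
  rw [mul_sub, mul_one, sub_mul, one_mul, sub_eq_zero, sub_eq_zero] at hcd
  rcases hcd with h | h <;> rcases hcd' with h' | h'
  · exact hp.ne_zero (by rw [h, h'])
  · apply hq.ne_one
    rw [sub_mul, one_mul, mul_sub, mul_one, ← h, sub_self, sub_zero, sub_eq_zero] at h'
    exact h'.symm
  · exact hq.ne_zero (by rw [h, h'])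
  · apply hp.ne_one
    rw [sub_mul, one_mul, mul_sub, mul_one, ← h, sub_sub, add_sub_cancel, sub_eq_zero] at h'
    exact h'.symm

end IsImage

end Image

section Theta

theorem one_sub_two_mul_theta {R S : Type*} [Ring R] [Ring S] [Algebra ℂ S] (φ : Rˣ ≃* Sˣ)
    {x : R} (hx : IsIdempotentElem x) : 1 - 2 * theta φ x = (φ (symUnit hx) : S) := by
  have h : (2 : ℂ) • (2 : ℂ)⁻¹ • (1 - (φ (symUnit hx) : S)) = 1 - φ (symUnit hx) := by
    rw [smul_smul, mul_inv_cancel₀ two_ne_zero, one_smul]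
  rw [theta, dif_pos hx, two_mul, ← two_smul ℂ, h, sub_sub_cancel]

variable {R S : Type*} [Ring R] [Algebra ℂ R] [NormedRing S] [NormedAlgebra ℂ S]
  [CompleteSpace S] [IsSimpleRing S]

theorem exists_map_eq_smul_one (φ : Rˣ ≃* Sˣ) (k : ℂˣ) (v : Rˣ) (hv : (v : R) = (k : ℂ) • 1) :
    ∃ μ : ℂˣ, (φ v : S) = (μ : ℂ) • 1 := by
  have hcomm : ∀ b, (φ v : S) * b = b * φ v := fun b => by
    refine (commute_of_commute_units (p := 1) (fun w _ => ?_) (by simp)).symm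
    have : φ.symm w * v = v * φ.symm w := by ext; simp [hv]
    simpa using congrArg (fun u => (φ u : S)) this
  obtain ⟨α, hα⟩ := exists_eq_smul_one_of_central hcomm
  have hα0 : α ≠ 0 := by
    rintro rfl
    exact (φ v).ne_zero (by rw [hα, zero_smul])
  exact ⟨Units.mk0 α hα0, hα⟩

theorem map_neg_one_units [Nontrivial R] (φ : Rˣ ≃* Sˣ) : φ (-1) = -1 := by
  obtain ⟨μ, hμ⟩ := exists_map_eq_smul_one φ (-1) (-1) (by simp)
  have h1 : (φ (-1) : S) * φ (-1) = 1 := by rw [← Units.val_mul, ← map_mul]; simp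
  rw [hμ, smul_mul_smul_comm, mul_one] at h1
  rcases mul_self_eq_one_iff.1
    (smul_left_injective ℂ (one_ne_zero (α := S)) (h1.trans (one_smul ℂ _).symm)) with h | h
  · exfalso
    have h2 : (-1 : Rˣ) = 1 := φ.injective (Units.ext (by rw [hμ, h]; simp))
    have h3 : (-1 : R) = 1 := by simpa using congrArg Units.val h2
    refine one_ne_zero (α := R) (eq_zero_of_two_mul ?_)
    rw [mul_one, ← one_add_one_eq_two]
    nth_rewrite 1 [← h3]
    simp
  · ext; rw [hμ, h]; simp

theorem theta_one_sub [Nontrivial R] (φ : Rˣ ≃* Sˣ) {x : R} (hx : IsIdempotentElem x) :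
    theta φ (1 - x) = 1 - theta φ x := by
  have h : symUnit hx.one_sub = -1 * symUnit hx := by
    ext
    change 1 - 2 * (1 - x) = -1 * (1 - 2 * x)
    noncomm_ring
  have h1 := one_sub_two_mul_theta φ hx.one_sub
  rw [h, map_mul, map_neg_one_units, Units.val_mul, ← one_sub_two_mul_theta φ hx] at h1
  refine sub_eq_zero.1 (eq_zero_of_two_mul ?_)
  have : 2 * (theta φ (1 - x) - (1 - theta φ x)) =
      ((-1 : Sˣ) : S) * (1 - 2 * theta φ x) - (1 - 2 * theta φ (1 - x)) := by
    rw [Units.val_neg, Units.val_one]; noncomm_ring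
  rw [this, h1, sub_self]

theorem IsNontrivialIdem.theta [Nontrivial R] (φ : Rˣ ≃* Sˣ) {x : R} (hx : IsNontrivialIdem x) :
    IsNontrivialIdem (theta φ x) where
  idem := by
    have h : (1 - 2 * _root_.theta φ x) * (1 - 2 * _root_.theta φ x) = 1 := by
      rw [one_sub_two_mul_theta φ hx.idem]
      have h1 : symUnit (e := x) hx.idem * symUnit (e := x) hx.idem = 1 :=
        mul_inv_cancel (symUnit (e := x) hx.idem)
      rw [← Units.val_mul, ← map_mul, h1, map_one, Units.val_one]
    refine sub_eq_zero.1 (eq_zero_of_two_mul (eq_zero_of_two_mul ?_))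
    rw [← sub_eq_zero.2 h]; noncomm_ring
  ne_zero h := hx.ne_zero (by
    have h1 := one_sub_two_mul_theta φ hx.idem
    rw [h, mul_zero, sub_zero] at h1
    have h2 : symUnit (e := x) hx.idem = 1 := φ.injective (Units.ext (by rw [← h1]; simp))
    have h3 : 1 - 2 * x = 1 := congrArg Units.val h2
    exact eq_zero_of_two_mul (by simpa using h3))
  ne_one h := hx.ne_one (by
    have h1 := one_sub_two_mul_theta φ hx.idem
    have h2 : symUnit (e := x) hx.idem = -1 :=
      φ.injective (Units.ext (by rw [← h1, h, map_neg_one_units, Units.val_neg]; norm_num))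
    have h3 : 1 - 2 * x = -1 := congrArg Units.val h2
    refine (sub_eq_zero.1 (eq_zero_of_two_mul ?_)).symm
    rw [mul_sub, mul_one, ← one_add_one_eq_two, add_sub_assoc, one_add_one_eq_two, h3]; simp)

theorem exists_isCoeffMaps [Nontrivial R] (φ : Rˣ ≃* Sˣ) {x : R} (hx : IsNontrivialIdem x) :
    ∃ a b, IsCoeffMaps φ x a b := by
  have ht := hx.theta φ
  set t := theta φ x
  have key : ∀ lam : ℂˣ, ∃ α β : ℂˣ,
      (φ (idemUnit hx.idem lam) : S) = (α : ℂ) • t + (β : ℂ) • (1 - t) := by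
    intro lam
    have hcomm : ∀ w : Sˣ, (w : S) * t = t * w →
        (w : S) * φ (idemUnit hx.idem lam) = φ (idemUnit hx.idem lam) * w := by
      intro w hw
      have h1 : w * φ (symUnit (e := x) hx.idem) = φ (symUnit (e := x) hx.idem) * w := by
        ext
        rw [Units.val_mul, Units.val_mul, ← one_sub_two_mul_theta φ hx.idem, mul_sub, sub_mul,
          mul_assoc, ← hw, mul_one, one_mul, ← mul_assoc, ← mul_assoc, two_mul, mul_two]
      have h2 := congrArg (fun u => (φ.symm u : R)) h1
      simp only [map_mul, MulEquiv.symm_apply_apply, Units.val_mul] at h2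
      change _ * (1 - 2 * x) = (1 - 2 * x) * _ at h2
      have h3 : ((φ.symm w : Rˣ) : R) * x = x * φ.symm w := by
        refine sub_eq_zero.1 (eq_zero_of_two_mul ?_)
        rw [← sub_eq_zero.2 h2.symm]; noncomm_ring
      have h4 : φ.symm w * idemUnit hx.idem lam = idemUnit hx.idem lam * φ.symm w := by
        ext
        change _ * ((lam : ℂ) • x + (1 - x)) = ((lam : ℂ) • x + (1 - x)) * _
        rw [mul_add, add_mul, mul_smul_comm, smul_mul_assoc, mul_sub, sub_mul, h3, mul_one, one_mul]
      simpa using congrArg (fun u => (φ u : S)) h4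
    have hself : (φ (symUnit (e := x) hx.idem) : S) * φ (idemUnit hx.idem lam) =
        φ (idemUnit hx.idem lam) * φ (symUnit (e := x) hx.idem) := by
      refine hcomm _ ?_
      rw [← one_sub_two_mul_theta φ hx.idem]; noncomm_ring
    rw [← one_sub_two_mul_theta φ hx.idem] at hself
    obtain ⟨α, β, h⟩ := exists_eq_smul_add_smul_of_commute_units ht.idem
      (v := (φ (idemUnit hx.idem lam) : S)) (by
      refine sub_eq_zero.1 (eq_zero_of_two_mul ?_)
      rw [← sub_eq_zero.2 hself]; noncomm_ring) hcomm
    have hα : α ≠ 0 := by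
      rintro rfl
      apply ht.ne_zero
      have := congrArg (t * ·) h
      simpa [ht.mul_one_sub] using this
    have hβ : β ≠ 0 := by
      rintro rfl
      apply ht.one_sub.ne_zero
      have := congrArg ((1 - t) * ·) h
      simpa [ht.one_sub_mul] using this
    exact ⟨Units.mk0 α hα, Units.mk0 β hβ, h⟩
  choose α β h using key
  have hmul : ∀ l m, α (l * m) = α l * α m ∧ β (l * m) = β l * β m := by
    intro l m
    have h1 : idemUnit hx.idem (l * m) = idemUnit hx.idem l * idemUnit hx.idem m := by
      ext
      change ((l * m : ℂˣ) : ℂ) • x + (1 - x) = ((l : ℂ) • x + (1 - x)) * ((m : ℂ) • x + (1 - x))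
      simp only [mul_add, add_mul, smul_mul_assoc, mul_smul_comm, hx.idem, hx.mul_one_sub,
        hx.one_sub_mul, hx.one_sub.idem, Units.val_mul, smul_zero, add_zero, zero_add]
      rw [smul_smul, mul_comm]
    have h2 := congrArg (fun u => (φ u : S)) h1
    simp only [map_mul, Units.val_mul, h] at h2
    simp only [mul_add, add_mul, smul_mul_smul_comm, ht.idem,
        ht.mul_one_sub, ht.one_sub_mul, ht.one_sub.idem, smul_zero, add_zero, zero_add] at h2
    obtain ⟨h3, h4⟩ := ht.coeff_ext h2
    exact ⟨Units.ext h3, Units.ext h4⟩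
  refine ⟨MonoidHom.mk' α fun l m => (hmul l m).1, MonoidHom.mk' β fun l m => (hmul l m).2,
    fun lam v hv => ?_⟩
  have : v = idemUnit hx.idem lam := Units.ext (by rw [hv, add_sub_assoc]; rfl)
  rw [this, h, theta_one_sub φ hx.idem]
  rfl

theorem IsCoeffMaps.map_neg_one [Nontrivial R] {φ : Rˣ ≃* Sˣ} {x : R} {a b : ℂˣ →* ℂˣ}
    (h : IsCoeffMaps φ x a b) (hx : IsNontrivialIdem x) : (a / b) (-1) = -1 := by
  have h1 := h (-1) (symUnit (e := x) hx.idem) (by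
    change 1 - 2 * x = _
    simp only [Units.val_neg, Units.val_one, neg_smul, one_smul]; noncomm_ring)
  rw [← one_sub_two_mul_theta φ hx.idem, theta_one_sub φ hx.idem] at h1
  have h2 : (-1 : ℂ) • theta φ x + (1 : ℂ) • (1 - theta φ x) = 1 - 2 * theta φ x := by
    simp only [neg_smul, one_smul]; noncomm_ring
  obtain ⟨h3, h4⟩ := (hx.theta φ).coeff_ext (h2.trans h1)
  have h5 : a (-1) = -1 := Units.ext (by rw [← h3]; simp)
  have h6 : b (-1) = 1 := Units.ext (by rw [← h4]; simp)
  rw [MonoidHom.div_apply, h5, h6, div_one]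

theorem IsCoeffMaps.isImage [Nontrivial R] {φ : Rˣ ≃* Sˣ} {x : R} {a b : ℂˣ →* ℂˣ}
    (h : IsCoeffMaps φ x a b) (hx : IsNontrivialIdem x) : IsImage φ (a / b) x (theta φ x) where
  toIsNontrivialIdem := hx.theta φ
  map_eq lam v hv := ⟨b lam, by
    rw [h lam v (by rw [hv, add_sub_assoc]), theta_one_sub φ hx.idem, smul_add, smul_smul,
      ← Units.val_mul, MonoidHom.div_apply, mul_div_cancel]⟩

end Theta

section Split

/-- `f = x + y` with `x` and `y` orthogonal nontrivial idempotents. -/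
structure IsSplit {R : Type*} [Ring R] (x y f : R) : Prop where
  left : IsNontrivialIdem x
  right : IsNontrivialIdem y
  mul : x * y = 0
  mul' : y * x = 0
  add : x + y = f

namespace IsSplit

variable {R : Type*} [Ring R] {x y f z : R}

theorem symm (h : IsSplit x y f) : IsSplit y x f :=
  ⟨h.right, h.left, h.mul', h.mul, by rw [add_comm, h.add]⟩

theorem mul_self (h : IsSplit x y f) : x * f = x := by
  rw [← h.add, mul_add, h.left.idem, h.mul, add_zero]

theorem self_mul (h : IsSplit x y f) : f * x = x := by
  rw [← h.add, add_mul, h.left.idem, h.mul', add_zero]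

theorem mul_eq_zero (h : IsSplit x y f) (hz : f * z = 0) : x * z = 0 := by
  rw [← h.mul_self, mul_assoc, hz, mul_zero]

theorem mul_eq_zero' (h : IsSplit x y f) (hz : z * f = 0) : z * x = 0 := by
  rw [← h.self_mul, ← mul_assoc, hz, zero_mul]

theorem conj (h : IsSplit x y f) (u : Rˣ) : IsSplit ((u : R) * x * ((u⁻¹ : Rˣ) : R))
    ((u : R) * y * ((u⁻¹ : Rˣ) : R)) ((u : R) * f * ((u⁻¹ : Rˣ) : R)) where
  left := h.left.conj u
  right := h.right.conj u
  mul := by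
    simp only [mul_assoc, Units.inv_mul_cancel_left]
    rw [← mul_assoc x, h.mul, zero_mul, mul_zero]
  mul' := by
    simp only [mul_assoc, Units.inv_mul_cancel_left]
    rw [← mul_assoc y, h.mul', zero_mul, mul_zero]
  add := by rw [← h.add, mul_add, add_mul]

/-- A nontrivial idempotent strictly below `f` splits `f`. -/
theorem of_mul_eq (hx : IsNontrivialIdem x) (hf : IsNontrivialIdem f) (h : x * f = x)
    (h' : f * x = x) (hne : x ≠ f) : IsSplit x (f - x) f where
  left := hx
  right :=
    { idem := by rw [sub_mul, mul_sub, mul_sub, hf.idem, hx.idem, h, h', sub_self, sub_zero]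
      ne_zero := fun h0 => hne (sub_eq_zero.1 h0).symm
      ne_one := fun h1 => hx.ne_zero (by
        have := congrArg (x * ·) h1
        simp only [mul_sub, h, hx.idem, sub_self, mul_one] at this
        exact this.symm) }
  mul := by rw [mul_sub, h, hx.idem, sub_self]
  mul' := by rw [sub_mul, h', hx.idem, sub_self]
  add := add_sub_cancel _ _

/-- If `x + y = f`, then `x` and `1 - f` are orthogonal with sum `1 - y`. -/
theorem compl (h : IsSplit x y f) (hf : IsNontrivialIdem f) : IsSplit x (1 - f) (1 - y) where
  left := h.left
  right := hf.one_sub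
  mul := by rw [mul_sub, h.mul_self, mul_one, sub_self]
  mul' := by rw [sub_mul, h.self_mul, one_mul, sub_self]
  add := by rw [← h.add]; abel

end IsSplit

theorem OddlyDecomposable.exists_isSplit {R : Type*} [Ring R] (hR : OddlyDecomposable R) {e f : R}
    (he : IsNontrivialIdem e) (hf : IsNontrivialIdem f) :
    ∃ (x y x' y' : R) (u : Rˣ), IsSplit x y f ∧ IsSplit x' y' e ∧
      x' = (u : R) * x * ((u⁻¹ : Rˣ) : R) := by
  obtain ⟨n, -, hn, g, hg, horth, hsum, hsim⟩ :=
    hR e f he.idem he.ne_zero he.ne_one hf.idem hf.ne_zero hf.ne_one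
  let i : Fin n := ⟨0, by lia⟩
  let j : Fin n := ⟨1, by lia⟩
  have hij : i ≠ j := by simp [i, j]
  have hgi : ∀ i, IsNontrivialIdem (g i) := fun i => ⟨(hg i).1, (hg i).2.1, (hg i).2.2⟩
  have h1 : ∀ i, g i * f = g i := fun i => by
    rw [← hsum, Finset.mul_sum, Finset.sum_eq_single i (fun k _ hk => horth _ _ hk.symm) (by simp),
      (hgi i).idem]
  have h2 : ∀ i, f * g i = g i := fun i => by
    rw [← hsum, Finset.sum_mul, Finset.sum_eq_single i (fun k _ hk => horth _ _ hk) (by simp),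
      (hgi i).idem]
  have hne : g i ≠ f := fun h => (hgi j).ne_zero (by rw [← h2 j, ← h, horth i j hij])
  obtain ⟨x', u, hx, hx0, hx1, hu, h3, h4, h5⟩ := hsim i
  exact ⟨g i, f - g i, x', e - x', u, .of_mul_eq (hgi i) hf (h1 i) (h2 i) hne,
    .of_mul_eq ⟨hx, hx0, hx1⟩ he h3 h4 h5, hu⟩

end Split

section IdemMap

/-- The properties shared by the maps `x ↦ q x` with `φ(λ x + 1 - x) ∈ ℂˣ (c(λ) q x + 1 - q x)`,
for a fixed homomorphism `c`. -/
structure IsIdemMap {R S : Type*} [Ring R] [Ring S] (q : R → S) : Prop where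
  nontrivial : ∀ {x}, IsNontrivialIdem x → IsNontrivialIdem (q x)
  one_sub : ∀ {x}, IsNontrivialIdem x → q (1 - x) = 1 - q x
  conj : ∀ u : Rˣ, ∃ v : Sˣ, ∀ {x}, IsNontrivialIdem x →
    q ((u : R) * x * ((u⁻¹ : Rˣ) : R)) = (v : S) * q x * ((v⁻¹ : Sˣ) : S)
  commute : ∀ {x y}, IsNontrivialIdem x → IsNontrivialIdem y → x * y = y * x →
    q x * q y = q y * q x
  add_or : ∀ {x y f}, IsSplit x y f → IsNontrivialIdem f → q f = q x + q y ∨ q f = q x + q y - 1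

theorem mul_eq_zero_of_idem_add {S : Type*} [Ring S] [Algebra ℂ S] {a b : S} (ha : a * a = a)
    (hb : b * b = b) (hab : a * b = b * a) (h : (a + b) * (a + b) = a + b) : a * b = 0 := by
  rw [mul_add, add_mul, add_mul, ha, hb, ← hab] at h
  refine eq_zero_of_two_mul ?_
  rw [two_mul]
  have : a * b + a * b = (a + a * b + (a * b + b)) - (a + b) := by abel
  rw [this, h, sub_self]

namespace IsIdemMap

variable {R S : Type*} [Ring R] [Ring S] {q : R → S} {x y z w f e g : R}

/-- Additivity of `q` on two of three orthogonal idempotents with sum `1` passes to another two. -/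
theorem add_compl (hq : IsIdemMap q) (hs : IsSplit x y f) (hf : IsNontrivialIdem f)
    (hP : q f = q x + q y) : q (1 - x) = q y + q (1 - f) := by
  rw [hq.one_sub hs.left, hq.one_sub hf, hP]; abel

theorem add_of_add_compl (hq : IsIdemMap q) (hs : IsSplit x y f) (hf : IsNontrivialIdem f)
    (hP : q (1 - x) = q y + q (1 - f)) : q f = q x + q y := by
  rw [hq.one_sub hs.left, hq.one_sub hf] at hP
  have : q x + q y = q y + (1 - q f) + q f + (q x - 1) := by abel
  rw [this, ← hP]; abel

variable [Algebra ℂ S]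

theorem mul_eq_zero (hq : IsIdemMap q) (hs : IsSplit x y f) (hf : IsNontrivialIdem f)
    (hP : q f = q x + q y) : q x * q y = 0 :=
  mul_eq_zero_of_idem_add (hq.nontrivial hs.left).idem (hq.nontrivial hs.right).idem
    (hq.commute hs.left hs.right (by rw [hs.mul, hs.mul'])) (by rw [← hP, (hq.nontrivial hf).idem])

theorem one_sub_mul_one_sub_eq_zero (hq : IsIdemMap q) (hs : IsSplit x y f)
    (hf : IsNontrivialIdem f) (hP : q f = q x + q y - 1) : (1 - q x) * (1 - q y) = 0 := by
  have h1 := hq.commute hs.left hs.right (by rw [hs.mul, hs.mul'])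
  have h2 : 1 - q x + (1 - q y) = 1 - q f := by rw [hP]; abel
  refine mul_eq_zero_of_idem_add (hq.nontrivial hs.left).one_sub.idem
    (hq.nontrivial hs.right).one_sub.idem ?_ (by rw [h2, (hq.nontrivial hf).one_sub.idem])
  simp only [mul_sub, sub_mul, h1, mul_one, one_mul]; abel

theorem mul_or (hq : IsIdemMap q) (hs : IsSplit x y f) (hf : IsNontrivialIdem f) :
    q x * q y = 0 ∨ (1 - q x) * (1 - q y) = 0 :=
  (hq.add_or hs hf).imp (hq.mul_eq_zero hs hf) (hq.one_sub_mul_one_sub_eq_zero hs hf)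

/-- For a partition of `1` into four idempotents, additivity of `q` on two of them implies
additivity on the other two. -/
theorem add_of_compl_add (hq : IsIdemMap q) (hf : IsNontrivialIdem f) (hxy : IsSplit x y f)
    (hzw : IsSplit z w (1 - f)) (hP : q f = q x + q y) : q (1 - f) = q z + q w := by
  refine (hq.add_or hzw hf.one_sub).resolve_right fun h => ?_
  have h0 := hf.mul_one_sub
  have h0' := hf.one_sub_mul
  have hsum : q x + q y + q z + q w = 2 := by
    have : q z + q w = 1 + (q z + q w - 1) := by abel
    rw [add_assoc, ← hP, this, ← h, hq.one_sub hf, ← one_add_one_eq_two]; abel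
  have horth : ∀ {a b c d}, IsSplit a b f → IsSplit c d (1 - f) → IsSplit a c (a + c) ∧
      IsNontrivialIdem (a + c) := fun {a b c d} hab hcd => by
    have h1 := hab.mul_eq_zero (hcd.mul_eq_zero' h0)
    have h2 := hcd.mul_eq_zero (hab.mul_eq_zero' h0')
    refine ⟨⟨hab.left, hcd.left, h1, h2, rfl⟩, hab.left.add hcd.left h1 h2 fun h => ?_⟩
    have h3 := congrArg (b * ·) h
    simp only [mul_add, hab.mul', hab.symm.mul_eq_zero (hcd.mul_eq_zero' h0), mul_one,
      add_zero] at h3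
    exact hab.right.ne_zero h3.symm
  have horth' : ∀ {a b c d}, IsSplit a b f → IsSplit c d (1 - f) → q a * q c = q c * q a :=
    fun hab hcd => by
      have := (horth hab hcd).1
      exact hq.commute hab.left hcd.left (by rw [this.mul, this.mul'])
  have hn : ∀ {a}, IsNontrivialIdem a → IsNontrivialIdem (q a) := hq.nontrivial
  have nx := hn hxy.left
  have ny := hn hxy.right
  have nz := hn hzw.left
  have nw := hn hzw.right
  have d1 := hq.mul_or hxy hf
  have d2 := hq.mul_or (horth hxy hzw).1 (horth hxy hzw).2
  have d3 := hq.mul_or (horth hxy hzw.symm).1 (horth hxy hzw.symm).2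
  have c1 := hq.commute hxy.left hxy.right (by rw [hxy.mul, hxy.mul'])
  have c2 := horth' hxy hzw
  have c3 := horth' hxy hzw.symm
  have c4 := horth' hxy.symm hzw
  have c5 := horth' hxy.symm hzw.symm
  have c6 := hq.commute hzw.left hzw.right (by rw [hzw.mul, hzw.mul'])
  generalize q x = x' at *
  generalize q y = y' at *
  generalize q z = z' at *
  generalize q w = w' at *
  obtain ⟨C, _, _, F, hF, hC⟩ := exists_commRing_model (s := {x', y', z', w'}) (by
    rintro a (rfl | rfl | rfl | rfl) b (rfl | rfl | rfl | rfl) <;> simp [*])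
  obtain ⟨x', rfl⟩ := hC x' (by simp)
  obtain ⟨y', rfl⟩ := hC y' (by simp)
  obtain ⟨z', rfl⟩ := hC z' (by simp)
  obtain ⟨w', rfl⟩ := hC w' (by simp)
  have hid : ∀ {a}, IsNontrivialIdem (F a) → a * a = a := fun ha => hF (by simpa using ha.idem)
  have hne : ∀ {a}, IsNontrivialIdem (F a) → a ≠ 0 ∧ a ≠ 1 := fun ha =>
    ⟨fun h0 => ha.ne_zero (by simp [h0]), fun h1 => ha.ne_one (by simp [h1])⟩
  have hd : ∀ {a b}, (F a * F b = 0 ∨ (1 - F a) * (1 - F b) = 0) →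
      (a * b = 0 ∨ (1 - a) * (1 - b) = 0) := fun h =>
    h.imp (fun h => hF (by simpa using h)) (fun h => hF (by simpa using h))
  exact four_idem_sum_ne_two (hid nx) (hid ny) (hid nz) (hid nw) (hne nx) (hne ny) (hne nz)
    (hne nw) (hd d1) (hd d2) (hd d3) (hF (by simpa [map_ofNat F 2] using hsum))

/-- Additivity of `q` at `e + f = g` is equivalent to additivity at any splitting of `e`. -/
theorem add_iff_add_of_isSplit (hq : IsIdemMap q) (hs : IsSplit e f g) (hg : IsNontrivialIdem g)
    (hxy : IsSplit x y e) : q g = q e + q f ↔ q e = q x + q y := by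
  have he := hs.left
  have hc : IsSplit f (1 - g) (1 - e) := hs.symm.compl hg
  constructor
  · intro h
    have := hq.add_of_compl_add he.one_sub hc (by rwa [sub_sub_cancel]) (hq.add_compl hs hg h)
    rwa [sub_sub_cancel] at this
  · intro h
    exact hq.add_of_add_compl hs hg (hq.add_of_compl_add he hxy hc h)

/-- Additivity of `q` on orthogonal pairs does not depend on the pair. -/
theorem add_of_add (hR : OddlyDecomposable R) (hq : IsIdemMap q) {e f s e' f' s' : R}
    (hs : IsSplit e f s) (hs' : IsNontrivialIdem s) (ht : IsSplit e' f' s')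
    (ht' : IsNontrivialIdem s') (hP : q s = q e + q f) : q s' = q e' + q f' := by
  obtain ⟨x, y, x', y', u, hxy, hxy', rfl⟩ := hR.exists_isSplit ht.left hs.left
  obtain ⟨a, b, -, -, -, hab, -, -⟩ := hR.exists_isSplit hxy'.left hxy'.left
  obtain ⟨v, hv⟩ := hq.conj u
  have hP1 := (hq.add_iff_add_of_isSplit hs hs' hxy).1 hP
  have hP2 := (hq.add_iff_add_of_isSplit (hxy.conj u) (hs.left.conj u) hab).1 (by
    rw [hv hs.left, hv hxy.left, hv hxy.right, hP1, mul_add, add_mul])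
  exact (hq.add_iff_add_of_isSplit ht ht' hxy').2
    ((hq.add_iff_add_of_isSplit hxy' ht.left hab).2 hP2)

end IsIdemMap

end IdemMap

section Family

variable {R S : Type*} [Ring R] [Algebra ℂ R] [Nontrivial R] [NormedRing S] [NormedAlgebra ℂ S]
  [CompleteSpace S] [IsSimpleRing S] {φ : Rˣ ≃* Sˣ} {c : ℂˣ →* ℂˣ} {e x y f : R} {p : S}

theorem IsNontrivialIdem.exists_isImage (φ : Rˣ ≃* Sˣ) (hx : IsNontrivialIdem x) :
    ∃ d : ℂˣ →* ℂˣ, d (-1) = -1 ∧ IsImage φ d x (_root_.theta φ x) := by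
  obtain ⟨a, b, h⟩ := exists_isCoeffMaps φ hx
  exact ⟨a / b, h.map_neg_one hx, h.isImage hx⟩

theorem IsImage.exists_of_isSplit (h : IsImage φ c x p) (hc : c (-1) = -1) (hs : IsSplit x y f)
    (hf : IsNontrivialIdem f) : ∃ q, IsImage φ c y q := by
  obtain ⟨d, hd, hq⟩ := hs.right.exists_isImage φ
  obtain ⟨m, hm, hr⟩ := hf.exists_isImage φ
  rw [← hs.add] at hr
  exact h.exists_of_orthogonal hq hr hc hd hm hs.left.idem hs.right.idem hs.mul hs.mul'

theorem IsImage.exists_isImage (hR : OddlyDecomposable R) (h : IsImage φ c e p)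
    (hc : c (-1) = -1) (he : IsNontrivialIdem e) (hx : IsNontrivialIdem x) :
    ∃ q, IsImage φ c x q := by
  obtain ⟨a, b, a', b', u, hab, hab', hu⟩ := hR.exists_isSplit he hx
  obtain ⟨q₁, h₁⟩ := (h.one_sub he.idem (exists_map_eq_smul_one φ)).exists_of_isSplit hc
    (hab'.compl he).symm hab'.right.one_sub
  have h₂ := h₁.conj u⁻¹
  have ha : ((u⁻¹ : Rˣ) : R) * a' * (((u⁻¹)⁻¹ : Rˣ) : R) = a := by
    rw [hu, inv_inv]; simp [mul_assoc]
  rw [ha] at h₂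
  obtain ⟨q₃, h₃⟩ := h₂.exists_of_isSplit hc (hab.compl hx) hab.right.one_sub
  have h₄ := h₃.one_sub hx.one_sub.idem (exists_map_eq_smul_one φ)
  rw [sub_sub_cancel] at h₄
  exact ⟨_, h₄⟩

theorem IsImage.exists_isIdemMap (hR : OddlyDecomposable R) (h : IsImage φ c e p)
    (hc : c (-1) = -1) (he : IsNontrivialIdem e) :
    ∃ q : R → S, IsIdemMap q ∧ ∀ {x}, IsNontrivialIdem x → IsImage φ c x (q x) := by
  have hex : ∀ x : R, ∃ q : S, IsNontrivialIdem x → IsImage φ c x q := fun x => by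
    by_cases hx : IsNontrivialIdem x
    · obtain ⟨q, hq⟩ := h.exists_isImage hR hc he hx
      exact ⟨q, fun _ => hq⟩
    · exact ⟨0, fun h => absurd h hx⟩
  choose q hq using hex
  refine ⟨q, ⟨fun hx => (hq _ hx).toIsNontrivialIdem, fun hx => ?_, fun u => ⟨φ u, fun hx => ?_⟩,
    fun hx hy hxy => ?_, fun hs hf => ?_⟩, fun hx => hq _ hx⟩
  · exact (hq _ hx.one_sub).unique ((hq _ hx).one_sub hx.idem (exists_map_eq_smul_one φ)) hc
      hx.one_sub.idem
  · exact (hq _ (hx.conj u)).unique ((hq _ hx).conj u) hc (hx.conj u).idem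
  · exact (hq _ hx).commute (hq _ hy) hc hc hx.idem hy.idem hxy
  · obtain rfl := hs.add
    exact (hq _ hs.left).add_eq_or (hq _ hs.right) (hq _ hf) hc hs.left.idem hs.right.idem hs.mul
      hs.mul'

theorem IsImage.eq_theta_or (h : IsImage φ c x p) (hc : c (-1) = -1) (hx : IsNontrivialIdem x) :
    theta φ x = p ∨ theta φ x = 1 - p := by
  obtain ⟨μ, hμ⟩ := h.map_symUnit hc hx.idem
  rw [← one_sub_two_mul_theta φ hx.idem] at hμ
  exact IsImage.eq_or_eq_one_sub (hx.theta φ).idem h.idem h.ne_one hμ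

end Family

namespace IsIdemMap

variable {R S : Type*} [Ring R] [Ring S] [Algebra ℂ S] {q : R → S} {e f s : R} {t : S}

theorem add_of_mul_eq_zero (hq : IsIdemMap q) (hs : IsSplit e f s) (hs' : IsNontrivialIdem s)
    (ht : t = q f ∨ t = 1 - q f) (h : q e * t = 0) : q s = q e + q f := by
  have he := hq.nontrivial hs.left
  have hf := hq.nontrivial hs.right
  refine (hq.add_or hs hs').resolve_right fun h' => ?_
  have h1 := hq.one_sub_mul_one_sub_eq_zero hs hs' h'
  rcases ht with rfl | rfl
  · apply (hq.nontrivial hs').ne_zero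
    rw [sub_mul, mul_sub, mul_sub, h] at h1
    rw [h', ← neg_eq_zero, ← h1]
    simp only [mul_one, one_mul]; abel
  · apply hf.ne_one
    rw [sub_mul, h, one_mul, sub_zero] at h1
    exact (sub_eq_zero.1 h1).symm

theorem ne_add_of_one_sub_mul_eq_zero (hq : IsIdemMap q) (hs : IsSplit e f s)
    (hs' : IsNontrivialIdem s) (ht : t = q f ∨ t = 1 - q f) (h : (1 - q e) * (1 - t) = 0) :
    q s ≠ q e + q f := fun h' => by
  have hf := hq.nontrivial hs.right
  have h1 := hq.mul_eq_zero hs hs' h'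
  rcases ht with rfl | rfl
  · apply (hq.nontrivial hs').ne_one
    rw [sub_mul, mul_sub, mul_sub, h1] at h
    rw [h', eq_comm, ← sub_eq_zero, ← h]
    simp only [mul_one, one_mul]; abel
  · apply hf.ne_zero
    rwa [sub_sub_cancel, sub_mul, h1, one_mul, sub_zero] at h

end IsIdemMap

/-- On `I_{c_e}`, the maps `θ` and `q` agree, where `q` is the map attached to `c_e`. -/
theorem isImage_theta_of_mem_Ic {R S : Type*} [Ring R] [Algebra ℂ R] [Nontrivial R] [NormedRing S]
    [NormedAlgebra ℂ S] [CompleteSpace S] [IsSimpleRing S] {φ : Rˣ ≃* Sˣ} {c : ℂˣ →* ℂˣ} {e g : R}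
    (he : IsNontrivialIdem e) (h : IsImage φ c e (theta φ e)) (hg : g ∈ Ic φ e) :
    IsNontrivialIdem g ∧ IsImage φ c g (theta φ g) := by
  obtain ⟨hg1, hg2, hg3, ae, be, ag, bg, h1, h2, h3⟩ := hg
  have hg : IsNontrivialIdem g := ⟨hg1, hg2, hg3⟩
  have h4 : c = ag / bg := by
    rw [h.hom_eq (h1.isImage he) he.idem]
    ext lam
    simpa [cOf, div_eq_mul_inv] using congrArg Units.val (h3 lam)
  exact ⟨hg, h4 ▸ h2.isImage hg⟩

theorem statement15 [IsSimpleRing A] [IsSimpleRing B]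
    (hA : OddlyDecomposable A) (φ : Aˣ ≃* Bˣ)
    (e f : A) (he : IsIdempotentElem e) (he0 : e ≠ 0) (he1 : e ≠ 1)
    (hf : IsIdempotentElem f) (hf0 : f ≠ 0) (hf1 : f ≠ 1)
    (hef : e * f = 0) (hfe : f * e = 0) (hone : e + f ≠ 1) :
    (theta (⇑φ) e * theta (⇑φ) f = 0 → PreservesOrthOn (⇑φ) (Ic (⇑φ) e)) ∧
    (theta (⇑φ) (1 - e) * theta (⇑φ) (1 - f) = 0 → FlipsOrthOn (⇑φ) (Ic (⇑φ) e)) := by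
  have he' : IsNontrivialIdem e := ⟨he, he0, he1⟩
  have hf' : IsNontrivialIdem f := ⟨hf, hf0, hf1⟩
  have hs : IsSplit e f (e + f) := ⟨he', hf', hef, hfe, rfl⟩
  have hs' : IsNontrivialIdem (e + f) := he'.add hf' hef hfe hone
  obtain ⟨c, hc, hce⟩ := he'.exists_isImage φ
  obtain ⟨q, hq, hqc⟩ := hce.exists_isIdemMap hA hc he'
  have hqe : theta φ e = q e := hce.unique (hqc he') hc he'.idem
  have hqf : theta φ f = q f ∨ theta φ f = 1 - q f := (hqc hf').eq_theta_or hc hf'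
  have hIc : ∀ {g}, g ∈ Ic φ e → IsNontrivialIdem g ∧ theta φ g = q g := fun hg => by
    obtain ⟨hg', hi⟩ := isImage_theta_of_mem_Ic he' hce hg
    exact ⟨hg', hi.unique (hqc hg') hc hg'.idem⟩
  refine ⟨fun h g₁ hg₁ g₂ hg₂ h12 h21 => ?_, fun h g₁ hg₁ g₂ hg₂ h12 h21 => ?_⟩ <;>
    obtain ⟨h₁, e₁⟩ := hIc hg₁ <;> obtain ⟨h₂, e₂⟩ := hIc hg₂ <;>
    by_cases h1 : g₁ + g₂ = 1
  · obtain rfl := eq_sub_of_add_eq' h1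
    rw [theta_one_sub φ h₁.idem, (h₁.theta φ).mul_one_sub]
  · have ht : IsSplit g₁ g₂ (g₁ + g₂) := ⟨h₁, h₂, h12, h21, rfl⟩
    have ht' := h₁.add h₂ h12 h21 h1
    rw [e₁, e₂]
    rw [hqe] at h
    exact hq.mul_eq_zero ht ht'
      (hq.add_of_add hA hs hs' ht ht' (hq.add_of_mul_eq_zero hs hs' hqf h))
  · obtain rfl := eq_sub_of_add_eq' h1
    rw [sub_sub_cancel, theta_one_sub φ h₁.idem, (h₁.theta φ).one_sub_mul]
  · have ht : IsSplit g₁ g₂ (g₁ + g₂) := ⟨h₁, h₂, h12, h21, rfl⟩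
    have ht' := h₁.add h₂ h12 h21 h1
    rw [theta_one_sub φ h₁.idem, theta_one_sub φ h₂.idem, e₁, e₂]
    rw [theta_one_sub φ he'.idem, theta_one_sub φ hf'.idem, hqe] at h
    exact hq.one_sub_mul_one_sub_eq_zero ht ht' <| (hq.add_or ht ht').resolve_left fun h' =>
      hq.ne_add_of_one_sub_mul_eq_zero hs hs' hqf h (hq.add_of_add hA ht ht' hs hs' h')

end
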